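/- arXiv:2205.08691 — 2 statements merged into one kernel-verified Lean document; each statement's English description precedes it below -/
import Mathlib

section
/- The complexity function satisfies p(h_{n+1}) = (1 + 1/L_n) h_{n+1} for all n >= 1. Moreover, if gamma_n / h_n tends to 0 as n tends to infinity, then liminf_{q -> infinity} p(q)/q = 1 + liminf_{n -> infinity} 1 / max(L_{n-1}, gamma_n + 1), and limsup_{q -> infinity} p(q)/q = 3/2 + limsup_{n -> infinity} 1 / (4 min(L_{n-1}, gamma_n + 1) - 2). -/
/-- The word sequence `B 1 = 0`, `B (n+1) = ((B n 1)^{γ n} B n)^{L n}` over the alphabet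
`{0,1}` (encoded as `Bool` with `false = 0`, `true = 1`). The value at `0` is an
irrelevant placeholder. -/
def Cseq (L γ : ℕ → ℕ) : ℕ → List Bool
  | 0 => [false]
  | 1 => [false]
  | n + 2 =>
      (List.replicate (L (n + 1))
        ((List.replicate (γ (n + 1)) (Cseq L γ (n + 1) ++ [true])).flatten ++
          Cseq L γ (n + 1))).flatten

/-- The language: all factors of some `B n`. -/
def InLangC (L γ : ℕ → ℕ) (w : List Bool) : Prop :=
  ∃ n, w <:+: Cseq L γ n

/-- The word complexity: the number of words of length `q` in the language. -/
noncomputable def complexityC (L γ : ℕ → ℕ) (q : ℕ) : ℕ :=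
  Set.ncard {w : List Bool | w.length = q ∧ InLangC L γ w}

/-- A word `w` is right-special if both `w0` and `w1` belong to the language. -/
def RightSpecialC (L γ : ℕ → ℕ) (w : List Bool) : Prop :=
  InLangC L γ (w ++ [false]) ∧ InLangC L γ (w ++ [true])

open Filter

/-- The spacer at level `j`: the letter `1` if `j` is even, nothing if `j` is odd. -/
def spacer (j : ℕ) : List Bool := List.replicate ((j + 1) % 2) true

/-- The words `W 0 = 0`, `W (j+1) = (W j · s j)^{k j} · W j`, where `s j` is the spacer at
level `j`. The words `Cseq L γ n` form a subsequence of these. -/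
def spacedWord (k : ℕ → ℕ) : ℕ → List Bool
  | 0 => [false]
  | j + 1 => (List.replicate (k j) (spacedWord k j ++ spacer j)).flatten ++ spacedWord k j

/-- The factors of the words `spacedWord k j`. -/
def InSpacedLang (k : ℕ → ℕ) (w : List Bool) : Prop := ∃ j, w <:+: spacedWord k j

/-- The words of length `q` in the language of `spacedWord k`. -/
def spacedLangOfLength (k : ℕ → ℕ) (q : ℕ) : Set (List Bool) :=
  {w | w.length = q ∧ InSpacedLang k w}

lemma spacer_cases (j : ℕ) :
    (spacer j = [true] ∧ spacer (j + 1) = []) ∨ (spacer j = [] ∧ spacer (j + 1) = [true]) := by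
  unfold spacer
  rcases Nat.mod_two_eq_zero_or_one j with h | h
  · left
    rw [show (j + 1) % 2 = 1 by omega, show (j + 1 + 1) % 2 = 0 by omega]; simp
  · right
    rw [show (j + 1) % 2 = 0 by omega, show (j + 1 + 1) % 2 = 1 by omega]; simp

lemma spacer_add_two (j : ℕ) : spacer (j + 2) = spacer j := by
  unfold spacer
  rw [show (j + 2 + 1) % 2 = (j + 1) % 2 by omega]

lemma length_spacer_add (j : ℕ) : (spacer j).length + (spacer (j + 1)).length = 1 := by
  rcases spacer_cases j with h | h <;> simp [h]

lemma flatten_replicate_add {α : Type*} (u : List α) (a b : ℕ) :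
    (List.replicate (a + b) u).flatten =
      (List.replicate a u).flatten ++ (List.replicate b u).flatten := by
  rw [List.replicate_add, List.flatten_append]

lemma flatten_replicate_one {α : Type*} (u : List α) : (List.replicate 1 u).flatten = u := by
  simp

lemma flatten_replicate_append_comm {α : Type*} (u v : List α) (n : ℕ) :
    (List.replicate n (u ++ v)).flatten ++ u = u ++ (List.replicate n (v ++ u)).flatten := by
  induction n with
  | zero => simp
  | succ n ih => rw [List.replicate_succ, List.flatten_cons, List.append_assoc, ih,
      List.replicate_succ, List.flatten_cons]; simp only [List.append_assoc]

section Language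

variable {k : ℕ → ℕ}

lemma spacedWord_suffix_succ (j : ℕ) : spacedWord k j <:+ spacedWord k (j + 1) :=
  ⟨_, rfl⟩

lemma spacedWord_prefix_succ (j : ℕ) : spacedWord k j <+: spacedWord k (j + 1) :=
  ⟨_, (flatten_replicate_append_comm _ _ _).symm⟩

lemma spacedWord_suffix {i j : ℕ} (h : i ≤ j) : spacedWord k i <:+ spacedWord k j := by
  induction j, h using Nat.le_induction with
  | base => exact List.suffix_refl _
  | succ j _ ih => exact ih.trans (spacedWord_suffix_succ j)

lemma spacedWord_isPrefix {i j : ℕ} (h : i ≤ j) : spacedWord k i <+: spacedWord k j := by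
  induction j, h using Nat.le_induction with
  | base => exact List.prefix_refl _
  | succ j _ ih => exact ih.trans (spacedWord_prefix_succ j)

lemma false_prefix_spacedWord (j : ℕ) : [false] <+: spacedWord k j :=
  spacedWord_isPrefix (k := k) (Nat.zero_le j)

lemma false_suffix_spacedWord (j : ℕ) : [false] <:+ spacedWord k j :=
  spacedWord_suffix (k := k) (Nat.zero_le j)

lemma one_le_length_spacedWord (j : ℕ) : 1 ≤ (spacedWord k j).length :=
  (false_prefix_spacedWord (k := k) j).length_le

lemma length_spacedWord_succ (j : ℕ) :
    (spacedWord k (j + 1)).length =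
      k j * ((spacedWord k j).length + (spacer j).length) + (spacedWord k j).length := by
  simp [spacedWord]

lemma InSpacedLang.mono {u w : List Bool} (h : InSpacedLang k w) (huw : u <:+: w) :
    InSpacedLang k u :=
  let ⟨j, hj⟩ := h
  ⟨j, huw.trans hj⟩

/-- A word that can be continued by either spacer followed by `0` is right special. -/
lemma right_special_of_spacers {u : List Bool} {j : ℕ}
    (h₀ : InSpacedLang k (u ++ spacer j ++ spacedWord k j))
    (h₁ : InSpacedLang k (u ++ spacer (j + 1) ++ spacedWord k j)) (b : Bool) :
    InSpacedLang k (u ++ [b]) := by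
  obtain ⟨r, hr⟩ := false_prefix_spacedWord (k := k) j
  rw [← hr] at h₀ h₁
  rcases spacer_cases j with ⟨e₀, e₁⟩ | ⟨e₀, e₁⟩ <;> rw [e₀] at h₀ <;> rw [e₁] at h₁ <;> cases b
  · exact h₁.mono ⟨[], r, by simp⟩
  · exact h₀.mono ⟨[], false :: r, by simp⟩
  · exact h₀.mono ⟨[], r, by simp⟩
  · exact h₁.mono ⟨[], false :: r, by simp⟩

lemma spacedWord_succ_double (j : ℕ) :
    spacedWord k (j + 1) ++ spacer j ++ spacedWord k (j + 1) =
      (List.replicate (2 * k j + 1) (spacedWord k j ++ spacer j)).flatten ++ spacedWord k j := by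
  rw [spacedWord, show 2 * k j + 1 = k j + 1 + k j by ring, flatten_replicate_add,
    flatten_replicate_add, flatten_replicate_one]
  simp only [List.append_assoc]

lemma InSpacedLang.of_suffix {u w : List Bool} {b : Bool} (h : InSpacedLang k (w ++ [b]))
    (huw : u <:+ w) : InSpacedLang k (u ++ [b]) := by
  obtain ⟨p, rfl⟩ := huw
  exact h.mono ⟨p, [], by simp⟩

lemma last_letter_suffix (i j : ℕ) (v : List Bool) :
    (spacer i = [true] → true :: v <:+ spacedWord k j ++ spacer i ++ v) ∧
      (spacer i = [] → false :: v <:+ spacedWord k j ++ spacer i ++ v) := by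
  constructor <;> intro h <;> rw [h]
  · exact ⟨spacedWord k j, by simp⟩
  · obtain ⟨p, hp⟩ := false_suffix_spacedWord (k := k) j
    exact ⟨p, by rw [← hp]; simp⟩

variable (hk : ∀ j, 1 ≤ k j)
include hk

lemma two_mul_length_spacedWord_le (j : ℕ) :
    2 * (spacedWord k j).length ≤ (spacedWord k (j + 1)).length := by
  rw [length_spacedWord_succ]
  nlinarith [hk j, Nat.zero_le (k j * (spacer j).length)]

lemma lt_length_spacedWord (j : ℕ) : j < (spacedWord k j).length := by
  induction j with
  | zero => simp [spacedWord]
  | succ j ih =>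
    have := two_mul_length_spacedWord_le hk j
    omega

lemma spacedWord_append_suffix (j : ℕ) :
    spacedWord k j ++ spacer j ++ spacedWord k j <:+ spacedWord k (j + 1) := by
  obtain ⟨m, hm⟩ := Nat.exists_eq_add_of_le' (hk j)
  refine ⟨(List.replicate m (spacedWord k j ++ spacer j)).flatten, ?_⟩
  rw [spacedWord, hm, flatten_replicate_add, flatten_replicate_one]
  simp only [List.append_assoc]

lemma spacedWord_append_isPrefix (j : ℕ) :
    spacedWord k j ++ spacer j ++ spacedWord k j <+: spacedWord k (j + 1) := by
  obtain ⟨m, hm⟩ := Nat.exists_eq_add_of_le (hk j)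
  refine ⟨(List.replicate m (spacer j ++ spacedWord k j)).flatten, ?_⟩
  rw [spacedWord, hm, flatten_replicate_append_comm, flatten_replicate_add,
    flatten_replicate_one]
  simp only [List.append_assoc]

lemma inSpacedLang_append_spacer (j : ℕ) :
    InSpacedLang k (spacedWord k j ++ spacer j ++ spacedWord k j) :=
  ⟨j + 1, (spacedWord_append_suffix hk j).isInfix⟩

lemma inSpacedLang_append_spacer_succ (j : ℕ) :
    InSpacedLang k (spacedWord k j ++ spacer (j + 1) ++ spacedWord k j) := by
  refine (inSpacedLang_append_spacer hk (j + 1)).mono ?_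
  obtain ⟨p, hp⟩ := spacedWord_suffix_succ (k := k) j
  obtain ⟨r, hr⟩ := spacedWord_prefix_succ (k := k) j
  refine ⟨p, r, ?_⟩
  conv_rhs => rw [List.append_assoc]
  conv_rhs => arg 1; rw [← hp]
  conv_rhs => arg 2; rw [← hr]
  simp only [List.append_assoc]

lemma spacedWord_right_special (j : ℕ) (b : Bool) : InSpacedLang k (spacedWord k j ++ [b]) :=
  right_special_of_spacers (inSpacedLang_append_spacer hk j)
    (inSpacedLang_append_spacer_succ hk j) b

lemma long_run_right_special (j : ℕ) (b : Bool) :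
    InSpacedLang k ((List.replicate (2 * k j) (spacedWord k j ++ spacer j)).flatten ++
      spacedWord k j ++ [b]) := by
  refine right_special_of_spacers (j := j) ?_ ?_ b
  · have h := inSpacedLang_append_spacer_succ hk (j + 1)
    rw [show j + 1 + 1 = j + 2 from rfl, spacer_add_two, spacedWord_succ_double,
      flatten_replicate_add, flatten_replicate_one] at h
    simpa only [List.append_assoc] using h
  · refine (inSpacedLang_append_spacer hk (j + 2)).mono ?_
    obtain ⟨p, hp⟩ := spacedWord_suffix_succ (k := k) (j + 1)
    obtain ⟨r, hr⟩ := spacedWord_append_isPrefix hk (j + 1)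
    obtain ⟨v, hv⟩ := spacedWord_prefix_succ (k := k) j
    have hd := spacedWord_succ_double (k := k) j
    rw [add_comm (2 * k j) 1, flatten_replicate_add, flatten_replicate_one] at hd
    refine ⟨p ++ (spacedWord k j ++ spacer j), v ++ r, ?_⟩
    calc _ = p ++ (spacedWord k j ++ spacer j ++
              (List.replicate (2 * k j) (spacedWord k j ++ spacer j)).flatten ++
              spacedWord k j) ++ spacer (j + 1) ++ (spacedWord k j ++ v) ++ r := by
            simp only [List.append_assoc]
      _ = p ++ spacedWord k (j + 1) ++ spacer (j + 2) ++
            (spacedWord k (j + 1) ++ spacer (j + 1) ++ spacedWord k (j + 1) ++ r) := by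
            rw [← hd, hv, spacer_add_two]; simp only [List.append_assoc]
      _ = _ := by rw [hp, hr]

end Language

section Counting

variable {k : ℕ → ℕ}

lemma spacedLangOfLength_finite (q : ℕ) : (spacedLangOfLength k q).Finite :=
  (List.finite_length_eq Bool q).subset fun _ h => h.1

lemma ncard_spacedLangOfLength_zero : (spacedLangOfLength k 0).ncard = 1 := by
  rw [Set.ncard_eq_one]
  refine ⟨[], Set.ext fun w => ?_⟩
  simp only [spacedLangOfLength, Set.mem_ofPred_eq, List.length_eq_zero_iff,
    Set.mem_singleton_iff, and_iff_left_iff_imp]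
  rintro rfl
  exact ⟨0, [], [false], rfl⟩

lemma List.infix_append_cases {α : Type*} {u a b : List α} (h : u <:+: a ++ b) :
    u <:+: b ∨ u <:+: a ++ b.take u.length := by
  obtain ⟨p, r, h⟩ := h
  rw [List.append_assoc, List.append_eq_append_iff] at h
  rcases h with ⟨c, rfl, h⟩ | ⟨c, rfl, h⟩
  · right
    refine ⟨p, (c ++ b.take u.length).drop u.length, ?_⟩
    have : u = (c ++ b.take u.length).take u.length := by
      have h₁ := congrArg (List.take u.length) h
      rw [List.take_left] at h₁
      conv_lhs => rw [h₁]
      rw [List.take_append, List.take_append, List.take_take, min_eq_left (Nat.sub_le _ _)]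
    conv_lhs => arg 1; arg 2; rw [this]
    rw [List.append_assoc, List.take_append_drop, List.append_assoc]
  · left
    exact ⟨c, r, by rw [h, List.append_assoc]⟩

/-- Concatenations of copies of `v` separated by at most one letter `1`. -/
inductive SpacedConcat (v : List Bool) : List Bool → Prop
  | base : SpacedConcat v v
  | step (j : ℕ) {w : List Bool} : SpacedConcat v w → SpacedConcat v (v ++ spacer j ++ w)

lemma SpacedConcat.append {v a b : List Bool} (ha : SpacedConcat v a) (hb : SpacedConcat v b)
    (j : ℕ) : SpacedConcat v (a ++ spacer j ++ b) := by
  induction ha with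
  | base => exact .step j hb
  | step i _ ih => simpa only [List.append_assoc] using SpacedConcat.step i ih

lemma SpacedConcat.isPrefix {v w : List Bool} (h : SpacedConcat v w) : v <+: w := by
  cases h with
  | base => exact List.prefix_refl _
  | step j h => exact ⟨_, (List.append_assoc _ _ _).symm⟩

lemma SpacedConcat.infix_double {v w u : List Bool} (h : SpacedConcat v w) (hu : u <:+: w)
    (hl : u.length = v.length) : ∃ j, u <:+: v ++ spacer j ++ v := by
  induction h with
  | base => exact ⟨0, hu.trans (by
      rw [List.append_assoc]
      exact (List.prefix_append _ _).isInfix)⟩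
  | @step j w h ih =>
    rcases List.infix_append_cases hu with hu | hu
    · exact ih hu
    · obtain ⟨r, rfl⟩ := h.isPrefix
      rw [hl, List.take_left] at hu
      exact ⟨j, hu⟩

lemma spacedConcat_spacedWord (j m : ℕ) :
    SpacedConcat (spacedWord k j) (spacedWord k (j + m)) := by
  induction m with
  | zero => exact .base
  | succ m ih =>
    rw [← add_assoc, spacedWord]
    generalize k (j + m) = n
    induction n with
    | zero => simpa using ih
    | succ n hn =>
      rw [List.replicate_succ, List.flatten_cons, List.append_assoc]
      exact ih.append hn _

lemma InSpacedLang.infix_double {u : List Bool} (h : InSpacedLang k u) {j : ℕ}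
    (hl : u.length = (spacedWord k j).length) :
    ∃ i, u <:+: spacedWord k j ++ spacer i ++ spacedWord k j := by
  obtain ⟨m, hm⟩ := h
  rcases le_total j m with hjm | hjm
  · obtain ⟨d, rfl⟩ := Nat.exists_eq_add_of_le hjm
    exact (spacedConcat_spacedWord j d).infix_double hm hl
  · exact SpacedConcat.base.infix_double (hm.trans (spacedWord_isPrefix hjm).isInfix) hl

lemma spacer_eq_or (i j : ℕ) : spacer i = spacer j ∨ spacer i = spacer (j + 1) := by
  rcases spacer_cases j with h | h <;> rcases spacer_cases i with h' | h' <;> simp [h, h']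

lemma List.IsInfix.eq_take_drop {α : Type*} {u x : List α} (h : u <:+: x) :
    ∃ i, i + u.length ≤ x.length ∧ u = (x.drop i).take u.length := by
  obtain ⟨p, r, rfl⟩ := h
  exact ⟨p.length, by simp, by simp⟩

/-- Factors of length `N` of a word of period `d`. -/
lemma take_drop_of_period {α : Type*} {x a b : List α} (N : ℕ) (ha : x = a ++ b)
    (hb : b <+: x) (had : 0 < a.length) (i : ℕ) (hi : i + N ≤ x.length) :
    ∃ i' < a.length, (x.drop i').take N = (x.drop i).take N := by
  induction i using Nat.strong_induction_on with
  | _ i ih =>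
    rcases lt_or_ge i a.length with h | h
    · exact ⟨i, h, rfl⟩
    · obtain ⟨c, rfl⟩ := Nat.exists_eq_add_of_le h
      obtain ⟨i', h', e⟩ := ih c (by omega) (by omega)
      refine ⟨i', h', e.trans ?_⟩
      obtain ⟨r, hr⟩ := hb
      have hx : x.length = a.length + b.length := by rw [ha, List.length_append]
      conv_lhs => rw [← hr]
      conv_rhs => rw [ha]
      rw [List.drop_append, List.drop_append, List.take_append_of_le_length]
      · rw [List.drop_eq_nil_of_le (Nat.le_add_right _ _), List.nil_append]
        simp
      · rw [List.length_drop]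
        omega

lemma length_long_run (j : ℕ) :
    ((List.replicate (2 * k j) (spacedWord k j ++ spacer j)).flatten ++
      spacedWord k j).length + (spacedWord k j).length = 2 * (spacedWord k (j + 1)).length := by
  rw [length_spacedWord_succ]
  simp
  ring

lemma ncard_spacedLangOfLength_le (j : ℕ) :
    (spacedLangOfLength k (spacedWord k (j + 1)).length).ncard ≤
      (spacedWord k (j + 1)).length + (spacedWord k j).length := by
  set v := spacedWord k (j + 1) with hv
  set x := v ++ spacer j ++ v with hx
  set y := v ++ spacer (j + 1) ++ v with hy
  set d := (spacedWord k j ++ spacer j).length with hd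
  have hd0 : 0 < d := by
    have := one_le_length_spacedWord (k := k) j
    rw [hd, List.length_append]; omega
  let N := v.length
  have hsub : spacedLangOfLength k N ⊆
      ↑((Finset.range d).image (fun i => (x.drop i).take N) ∪
        (Finset.Ico 1 (N + (spacer (j + 1)).length)).image (fun i => (y.drop i).take N)) := by
    rintro u ⟨hul, hu⟩
    have hxper : ∀ i, i + N ≤ x.length → ∃ i' < d, (x.drop i').take N = (x.drop i).take N := by
      intro i hi
      refine take_drop_of_period N
        (b := (List.replicate (2 * k j) (spacedWord k j ++ spacer j)).flatten ++ spacedWord k j)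
        ?_ ?_ hd0 i hi
      · rw [hx, hv, spacedWord_succ_double, add_comm, flatten_replicate_add,
          flatten_replicate_one, List.append_assoc]
      · rw [hx, hv, spacedWord_succ_double, flatten_replicate_add, flatten_replicate_one]
        exact ⟨spacer j ++ spacedWord k j, by simp only [List.append_assoc]⟩
    have hv0 : v = (x.drop 0).take N := by simp [hx, N]
    have hvmem : ∃ i' < d, (x.drop i').take N = v := by
      obtain ⟨i', h, e⟩ := hxper 0 (by simp [hx, N])
      exact ⟨i', h, e.trans hv0.symm⟩
    simp only [Finset.coe_union, Finset.coe_image, Finset.coe_range, Finset.coe_Ico,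
      Set.mem_union, Set.mem_image, Set.mem_Iio, Set.mem_Ico]
    obtain ⟨i, hi⟩ := hu.infix_double hul
    rcases spacer_eq_or i j with h | h <;> rw [h] at hi <;>
      obtain ⟨a, ha, e⟩ := hi.eq_take_drop <;> rw [hul] at ha e
    · left
      obtain ⟨i', h, e'⟩ := hxper a ha
      exact ⟨i', h, e'.trans e.symm⟩
    · have hyl : y.length = N + (spacer (j + 1)).length + N := by simp [hy, N, add_assoc]
      rw [hyl] at ha
      rcases Nat.eq_zero_or_pos a with h0 | h0
      · left
        rw [e, h0]
        have : v = (y.drop 0).take N := by simp [hy, N]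
        rwa [← this]
      · rcases lt_or_ge a (N + (spacer (j + 1)).length) with h1 | h1
        · exact Or.inr ⟨a, ⟨h0, h1⟩, e.symm⟩
        · left
          obtain rfl : a = N + (spacer (j + 1)).length := by omega
          have : u = v := by
            rw [e, ← hv, ← List.length_append, List.drop_left, List.take_length]
          rwa [this]
  have h1 := Set.ncard_le_ncard hsub (Finset.finite_toSet _)
  rw [Set.ncard_coe_finset] at h1
  have h2 := h1.trans (Finset.card_union_le _ _)
  have h3 := Finset.card_image_le (s := Finset.range d) (f := fun i => (x.drop i).take N)
  have h4 := Finset.card_image_le (s := Finset.Ico 1 (N + (spacer (j + 1)).length))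
    (f := fun i => (y.drop i).take N)
  rw [Finset.card_range] at h3
  rw [Nat.card_Ico] at h4
  have h5 := length_spacer_add j
  have h6 : d = (spacedWord k j).length + (spacer j).length := by simp [hd]
  have h7 : 1 ≤ v.length := one_le_length_spacedWord _
  change (spacedLangOfLength k N).ncard ≤ N + _
  have h8 : N = v.length := rfl
  omega

variable (hk : ∀ j, 1 ≤ k j)
include hk

lemma inSpacedLang_extend {w : List Bool} (h : InSpacedLang k w) :
    ∃ b, InSpacedLang k (w ++ [b]) := by
  obtain ⟨j, p, r, h⟩ := h
  have hj := spacedWord_right_special hk j false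
  rw [← h] at hj
  cases r with
  | nil => exact ⟨false, hj.mono ⟨p, [], by simp⟩⟩
  | cons b r => exact ⟨b, hj.mono ⟨p, r ++ [false], by simp⟩⟩

lemma ncard_spacedLangOfLength_add_le (q : ℕ) (R : Finset (List Bool))
    (hR : ∀ w ∈ R, w.length = q ∧ ∀ b, InSpacedLang k (w ++ [b])) :
    (spacedLangOfLength k q).ncard + R.card ≤ (spacedLangOfLength k (q + 1)).ncard := by
  let E : Bool → Set (List Bool) := fun b => {w | w.length = q ∧ InSpacedLang k (w ++ [b])}
  have hfin (b) : (E b).Finite := (List.finite_length_eq Bool q).subset fun _ h => h.1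
  have hinj (b : Bool) : Function.Injective (fun w : List Bool => w ++ [b]) :=
    fun _ _ h => List.append_cancel_right h
  have h1 : (spacedLangOfLength k q).ncard ≤ (E false ∪ E true).ncard := by
    refine Set.ncard_le_ncard ?_ ((hfin _).union (hfin _))
    rintro w ⟨hl, hw⟩
    obtain ⟨b, hb⟩ := inSpacedLang_extend hk hw
    cases b
    · exact Or.inl ⟨hl, hb⟩
    · exact Or.inr ⟨hl, hb⟩
  have h2 : R.card ≤ (E false ∩ E true).ncard := by
    rw [← Set.ncard_coe_finset]
    exact Set.ncard_le_ncard (fun w hw => ⟨⟨(hR w hw).1, (hR w hw).2 _⟩, (hR w hw).1,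
      (hR w hw).2 _⟩) ((hfin _).inter_of_left _)
  have h3 := Set.ncard_union_add_ncard_inter (E false) (E true) (hfin _) (hfin _)
  have h4 : ((fun w : List Bool => w ++ [false]) '' E false ∪
      (fun w : List Bool => w ++ [true]) '' E true).ncard = (E false).ncard + (E true).ncard := by
    rw [Set.ncard_union_eq _ ((hfin _).image _) ((hfin _).image _),
      Set.ncard_image_of_injective _ (hinj _), Set.ncard_image_of_injective _ (hinj _)]
    rw [Set.disjoint_left]
    rintro _ ⟨w, _, rfl⟩ ⟨w', _, h⟩
    have := (List.append_inj' h rfl).2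
    simp at this
  have h5 : ((fun w : List Bool => w ++ [false]) '' E false ∪
      (fun w : List Bool => w ++ [true]) '' E true).ncard ≤
        (spacedLangOfLength k (q + 1)).ncard := by
    refine Set.ncard_le_ncard ?_ (spacedLangOfLength_finite _)
    rintro _ (⟨w, ⟨hl, hw⟩, rfl⟩ | ⟨w, ⟨hl, hw⟩, rfl⟩) <;> exact ⟨by simp [hl], hw⟩
  omega

lemma ncard_spacedLangOfLength_succ (q : ℕ) :
    (spacedLangOfLength k q).ncard + 1 ≤ (spacedLangOfLength k (q + 1)).ncard := by
  let w := spacedWord k q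
  have hw : q ≤ w.length := (lt_length_spacedWord hk q).le
  refine ncard_spacedLangOfLength_add_le hk q {w.drop (w.length - q)} fun u hu => ?_
  rw [Finset.mem_singleton] at hu
  subst hu
  exact ⟨by rw [List.length_drop]; omega,
    fun b => (spacedWord_right_special hk q b).of_suffix (List.drop_suffix _ _)⟩

lemma ncard_spacedLangOfLength_add_two (j q : ℕ) (h₁ : (spacedWord k (j + 1)).length < q)
    (h₂ : q + (spacedWord k j).length ≤ 2 * (spacedWord k (j + 1)).length) :
    (spacedLangOfLength k q).ncard + 2 ≤ (spacedLangOfLength k (q + 1)).ncard := by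
  let w := spacedWord k (j + 2)
  let u := (List.replicate (2 * k j) (spacedWord k j ++ spacer j)).flatten ++ spacedWord k j
  have hu : u.length + (spacedWord k j).length = 2 * (spacedWord k (j + 1)).length :=
    length_long_run j
  have hw : 2 * (spacedWord k (j + 1)).length ≤ w.length := two_mul_length_spacedWord_le hk _
  have hne : w.drop (w.length - q) ≠ u.drop (u.length - q) := by
    intro he
    have hv : ∀ b₀ b₁ : Bool, b₀ :: spacedWord k (j + 1) <:+ w →
        b₁ :: spacedWord k (j + 1) <:+ u → b₀ = b₁ := by
      intro b₀ b₁ h₀ h₁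
      have e₀ := List.suffix_of_suffix_length_le h₀ (List.drop_suffix (w.length - q) w)
        (by rw [List.length_drop, List.length_cons]; omega)
      have e₁ := List.suffix_of_suffix_length_le h₁ (List.drop_suffix (u.length - q) u)
        (by rw [List.length_drop, List.length_cons]; omega)
      rw [← he] at e₁
      have := (List.suffix_of_suffix_length_le e₀ e₁ (by simp)).eq_of_length (by simp)
      exact (List.cons.inj this).1
    have hws := spacedWord_append_suffix hk (j + 1)
    have hus : spacedWord k j ++ spacer j ++ spacedWord k (j + 1) <:+ u := by
      obtain ⟨m, hm⟩ := Nat.exists_eq_add_of_le' (hk j)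
      refine ⟨(List.replicate m (spacedWord k j ++ spacer j)).flatten, ?_⟩
      simp only [u]
      rw [spacedWord, show 2 * k j = m + 1 + k j by omega, flatten_replicate_add _ (m + 1),
        flatten_replicate_add, flatten_replicate_one]
      simp only [List.append_assoc]
    have l₀ := last_letter_suffix (k := k) (j + 1) (j + 1) (spacedWord k (j + 1))
    have l₁ := last_letter_suffix (k := k) j j (spacedWord k (j + 1))
    rcases spacer_cases j with ⟨e₀, e₁⟩ | ⟨e₀, e₁⟩
    · exact Bool.false_ne_true (hv _ _ ((l₀.2 e₁).trans hws) ((l₁.1 e₀).trans hus))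
    · exact Bool.false_ne_true (hv _ _ ((l₀.1 e₁).trans hws) ((l₁.2 e₀).trans hus)).symm
  rw [← Finset.card_pair hne]
  refine ncard_spacedLangOfLength_add_le hk q _ fun x hx => ?_
  rw [Finset.mem_insert, Finset.mem_singleton] at hx
  rcases hx with rfl | rfl
  · exact ⟨by rw [List.length_drop]; omega,
      fun b => (spacedWord_right_special hk _ b).of_suffix (List.drop_suffix _ w)⟩
  · exact ⟨by rw [List.length_drop]; omega,
      fun b => (long_run_right_special hk j b).of_suffix (List.drop_suffix _ u)⟩

end Counting

/-- The growth of a function `P` whose increments are at least `1`, and at least `2` on the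
intervals `(ℓ (j+1), 2 ℓ (j+1) - ℓ j]`, and whose values at the `ℓ (j+1)` are no larger than
these increments force. -/
structure HasSlopes (P ℓ : ℕ → ℕ) : Prop where
  zero : P 0 = 1
  ell_zero : ℓ 0 = 1
  two_mul_le : ∀ j, 2 * ℓ j ≤ ℓ (j + 1)
  one_le_ell : ∀ j, 1 ≤ ℓ j
  lt_ell : ∀ j, j < ℓ j
  add_one_le : ∀ q, P q + 1 ≤ P (q + 1)
  add_two_le : ∀ j q, ℓ (j + 1) < q → q + ℓ j ≤ 2 * ℓ (j + 1) → P q + 2 ≤ P (q + 1)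
  apply_ell_le : ∀ j, P (ℓ (j + 1)) ≤ ℓ (j + 1) + ℓ j

lemma add_mul_le_of_step {P : ℕ → ℕ} {c a : ℕ} (m : ℕ)
    (h : ∀ i < m, P (a + i) + c ≤ P (a + i + 1)) : P a + c * m ≤ P (a + m) := by
  induction m with
  | zero => simp
  | succ m ih =>
    have h₁ := ih fun i hi => h i (hi.trans (Nat.lt_succ_self m))
    have h₂ := h m (Nat.lt_succ_self m)
    rw [← add_assoc, mul_add]
    omega

namespace HasSlopes

variable {P ℓ : ℕ → ℕ} (h : HasSlopes P ℓ)
include h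

lemma add_le {a b : ℕ} (hab : a ≤ b) : P a + (b - a) ≤ P b := by
  obtain ⟨m, rfl⟩ := Nat.exists_eq_add_of_le hab
  have := add_mul_le_of_step (P := P) (c := 1) (a := a) m fun i _ => h.add_one_le _
  rw [Nat.add_sub_cancel_left]
  omega

lemma add_two_mul_le {a b j : ℕ} (hab : a ≤ b) (ha : ℓ (j + 1) < a)
    (hb : b + ℓ j ≤ 2 * ℓ (j + 1) + 1) : P a + 2 * (b - a) ≤ P b := by
  obtain ⟨m, rfl⟩ := Nat.exists_eq_add_of_le hab
  have := add_mul_le_of_step (P := P) (c := 2) (a := a) m fun i _ =>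
    h.add_two_le j _ (by omega) (by omega)
  rw [Nat.add_sub_cancel_left]
  omega

lemma apply_ell (j : ℕ) : P (ℓ (j + 1)) = ℓ (j + 1) + ℓ j := by
  refine le_antisymm (h.apply_ell_le j) ?_
  induction j with
  | zero =>
    have h₁ := h.add_le (Nat.zero_le (ℓ (0 + 1)))
    have h₂ := h.zero
    have h₃ := h.ell_zero
    omega
  | succ j ih =>
    have h₁ := h.two_mul_le j
    have h₂ := h.two_mul_le (j + 1)
    have h₃ := h.one_le_ell j
    have h₄ := h.add_one_le (ℓ (j + 1))
    have h₅ := h.add_two_mul_le (j := j) (a := ℓ (j + 1) + 1) (b := 2 * ℓ (j + 1) + 1 - ℓ j)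
      (by omega) (by omega) (by omega)
    have h₆ := h.add_le (a := 2 * ℓ (j + 1) + 1 - ℓ j) (b := ℓ (j + 1 + 1)) (by omega)
    omega

lemma apply_eq_min {j q : ℕ} (h₁ : ℓ (j + 1) < q) (h₂ : q ≤ ℓ (j + 2)) :
    P q = min (2 * q - 1 + ℓ j - ℓ (j + 1)) (q + ℓ (j + 1)) := by
  have a₁ := h.two_mul_le j
  have a₂ := h.two_mul_le (j + 1)
  have a₃ := h.one_le_ell j
  have a₄ := h.apply_ell j
  have a₅ := h.apply_ell (j + 1)
  have a₆ := h.add_one_le (ℓ (j + 1))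
  have a₇ := h.add_le h₂
  change 2 * ℓ (j + 1) ≤ ℓ (j + 2) at a₂
  change P (ℓ (j + 2)) = ℓ (j + 2) + ℓ (j + 1) at a₅
  have a₈ := h.add_le (a := 2 * ℓ (j + 1) + 1 - ℓ j) (b := ℓ (j + 2)) (by omega)
  rcases le_total q (2 * ℓ (j + 1) + 1 - ℓ j) with hq | hq
  · have b₁ := h.add_two_mul_le (j := j) (a := ℓ (j + 1) + 1) (b := q)
      (by omega) (by omega) (by omega)
    have b₂ := h.add_two_mul_le (j := j) hq h₁ (by omega)
    omega
  · have b₁ := h.add_two_mul_le (j := j) (a := ℓ (j + 1) + 1) (b := 2 * ℓ (j + 1) + 1 - ℓ j)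
      (by omega) (by omega) (by omega)
    have b₂ := h.add_le hq
    omega

lemma exists_between {N q : ℕ} (hq : ℓ (N + 1) < q) :
    ∃ j, N ≤ j ∧ ℓ (j + 1) < q ∧ q ≤ ℓ (j + 2) := by
  have hex : ∃ i, q ≤ ℓ (N + i + 2) := ⟨q, by have := h.lt_ell (N + q + 2); omega⟩
  classical
  refine ⟨N + Nat.find hex, Nat.le_add_right _ _, ?_, Nat.find_spec hex⟩
  rcases Nat.eq_zero_or_pos (Nat.find hex) with h0 | h0
  · rwa [h0]
  · have := Nat.find_min hex (Nat.sub_lt h0 one_pos)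
    rw [not_le, show N + (Nat.find hex - 1) + 2 = N + Nat.find hex + 1 by omega] at this
    exact this

end HasSlopes

lemma hasSlopes_spacedLang {k : ℕ → ℕ} (hk : ∀ j, 1 ≤ k j) :
    HasSlopes (fun q => (spacedLangOfLength k q).ncard) (fun j => (spacedWord k j).length) where
  zero := ncard_spacedLangOfLength_zero
  ell_zero := rfl
  two_mul_le := two_mul_length_spacedWord_le hk
  one_le_ell := one_le_length_spacedWord
  lt_ell := lt_length_spacedWord hk
  add_one_le := ncard_spacedLangOfLength_succ hk
  add_two_le := ncard_spacedLangOfLength_add_two hk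
  apply_ell_le := ncard_spacedLangOfLength_le

section Asymptotics

lemma liminf_le_liminf_of_approx {u v : ℕ → ℝ} (hu : atTop.IsBoundedUnder (· ≤ ·) u)
    (hv : atTop.IsBoundedUnder (· ≥ ·) v)
    (h : ∀ ε > 0, ∀ N, ∀ᶠ q in atTop, ∃ n ≥ N, v n ≤ u q + ε) :
    atTop.liminf v ≤ atTop.liminf u := by
  refine le_of_forall_lt fun a ha => ?_
  obtain ⟨b, hab, hb⟩ := exists_between ha
  obtain ⟨N, hN⟩ := eventually_atTop.1 (eventually_lt_of_lt_liminf hb hv)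
  obtain ⟨c, hac, hcb⟩ := exists_between hab
  refine hac.trans_le (le_liminf_of_le hu.isCoboundedUnder_ge ?_)
  filter_upwards [h (b - c) (sub_pos.2 hcb) N] with q ⟨n, hn, hq⟩
  linarith [hN n hn]

lemma limsup_le_limsup_of_approx {u v : ℕ → ℝ} (hu : atTop.IsBoundedUnder (· ≥ ·) u)
    (hv : atTop.IsBoundedUnder (· ≤ ·) v)
    (h : ∀ ε > 0, ∀ N, ∀ᶠ q in atTop, ∃ n ≥ N, u q ≤ v n + ε) :
    atTop.limsup u ≤ atTop.limsup v := by
  refine le_of_forall_gt fun a ha => ?_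
  obtain ⟨b, hb, hba⟩ := exists_between ha
  obtain ⟨N, hN⟩ := eventually_atTop.1 (eventually_lt_of_limsup_lt hb hv)
  obtain ⟨c, hbc, hca⟩ := exists_between hba
  refine (limsup_le_of_le hu.isCoboundedUnder_le ?_).trans_lt hca
  filter_upwards [h (c - b) (sub_pos.2 hbc) N] with q ⟨n, hn, hq⟩
  linarith [hN n hn]

lemma isBoundedUnder_of_mem_Icc {u : ℕ → ℝ} {a b : ℝ}
    (h : ∀ᶠ n in atTop, u n ∈ Set.Icc a b) :
    atTop.IsBoundedUnder (· ≤ ·) u ∧ atTop.IsBoundedUnder (· ≥ ·) u :=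
  ⟨isBoundedUnder_of_eventually_le (h.mono fun _ h => h.2),
    isBoundedUnder_of_eventually_ge (h.mono fun _ h => h.1)⟩

lemma one_div_mem_Icc {x : ℝ} (hx : 2 ≤ x) : 1 / x ∈ Set.Icc (0 : ℝ) 1 :=
  ⟨by positivity, by rw [div_le_one (by positivity)]; linarith⟩

lemma one_div_sub_mem_Icc {x : ℝ} (hx : 2 ≤ x) : 1 / (4 * x - 2) ∈ Set.Icc (0 : ℝ) 1 :=
  one_div_mem_Icc (by linarith)

variable {P ℓ : ℕ → ℕ} {x e : ℕ → ℝ}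

namespace HasSlopes

lemma div_le_of_mem (h : HasSlopes P ℓ) {j q : ℕ} (h₁ : ℓ (j + 1) < q) (h₂ : q ≤ ℓ (j + 2))
    (hx2 : 2 ≤ x j) (hx : x j * ℓ j ≤ ℓ (j + 1)) :
    (P q : ℝ) / q ≤ 3 / 2 + 1 / (4 * x j - 2) := by
  have hP := h.apply_eq_min h₁ h₂
  have hP₁ : (P q : ℝ) ≤ 2 * q + ℓ j - ℓ (j + 1) := by
    rw [le_sub_iff_add_le]
    exact_mod_cast show P q + ℓ (j + 1) ≤ 2 * q + ℓ j by omega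
  have hP₂ : (P q : ℝ) ≤ q + ℓ (j + 1) := by exact_mod_cast show P q ≤ q + ℓ (j + 1) by omega
  have hq0 : (0 : ℝ) < q := by exact_mod_cast (Nat.zero_le _).trans_lt h₁
  have hd : 0 < 4 * x j - 2 := by linarith
  rw [show 3 / 2 + 1 / (4 * x j - 2) = (6 * x j - 2) / (4 * x j - 2) by field_simp; ring,
    div_le_div_iff₀ hq0 hd]
  nlinarith

lemma exists_le_div_of_mem (h : HasSlopes P ℓ) {j q : ℕ} (h₁ : ℓ (j + 1) < q)
    (h₂ : q ≤ ℓ (j + 2)) :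
    ∃ i, j ≤ i ∧ 1 + (ℓ i : ℝ) / ℓ (i + 1) ≤ (P q : ℝ) / q + 1 / q := by
  have hP := h.apply_eq_min h₁ h₂
  have hq0 : (0 : ℝ) < q := by exact_mod_cast (Nat.zero_le _).trans_lt h₁
  rw [← add_div]
  rcases min_choice (2 * q - 1 + ℓ j - ℓ (j + 1)) (q + ℓ (j + 1)) with hm | hm <;> rw [hm] at hP
  · refine ⟨j, le_rfl, ?_⟩
    have hp : (0 : ℝ) < ℓ (j + 1) := by exact_mod_cast h.one_le_ell (j + 1)
    have hle : (ℓ j : ℝ) ≤ ℓ (j + 1) := by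
      have := h.two_mul_le j
      exact_mod_cast show ℓ j ≤ ℓ (j + 1) by omega
    have hq : (ℓ (j + 1) : ℝ) ≤ q := by exact_mod_cast h₁.le
    have hPq : (P q : ℝ) + 1 = 2 * q + ℓ j - ℓ (j + 1) := by
      rw [eq_sub_iff_add_eq]
      exact_mod_cast show P q + 1 + ℓ (j + 1) = 2 * q + ℓ j by omega
    rw [hPq, le_div_iff₀ hq0, one_add_div hp.ne', div_mul_eq_mul_div, div_le_iff₀ hp]
    nlinarith
  · refine ⟨j + 1, Nat.le_succ j, ?_⟩
    have hp : (0 : ℝ) < ℓ (j + 2) := by exact_mod_cast h.one_le_ell (j + 2)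
    have hq : (q : ℝ) ≤ ℓ (j + 2) := by exact_mod_cast h₂
    have hle : (ℓ (j + 1) : ℝ) / ℓ (j + 2) ≤ ℓ (j + 1) / q := by gcongr
    rw [hP, Nat.cast_add, add_div, add_div, div_self hq0.ne']
    have : (0 : ℝ) ≤ 1 / q := by positivity
    linarith

lemma isBoundedUnder_div (h : HasSlopes P ℓ) :
    atTop.IsBoundedUnder (· ≤ ·) (fun q => (P q : ℝ) / q) ∧
      atTop.IsBoundedUnder (· ≥ ·) (fun q => (P q : ℝ) / q) := by
  refine isBoundedUnder_of_mem_Icc (a := 0) (b := 2) ?_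
  filter_upwards [eventually_gt_atTop (ℓ 1)] with q hq
  obtain ⟨j, -, h₁, h₂⟩ := h.exists_between (N := 0) hq
  refine ⟨by positivity, ?_⟩
  have hq0 : (0 : ℝ) < q := by exact_mod_cast (Nat.zero_le _).trans_lt hq
  rw [div_le_iff₀ hq0]
  have := h.apply_eq_min h₁ h₂
  have h₃ : P q ≤ 2 * q := by omega
  exact_mod_cast h₃

lemma one_div_le_ratio_add (h : HasSlopes P ℓ) {j : ℕ} (hx2 : 2 ≤ x j) (he0 : 0 ≤ e j)
    (he : ℓ (j + 1) ≤ x j * ℓ j + e j * ℓ j) : 1 / x j ≤ (ℓ j : ℝ) / ℓ (j + 1) + e j := by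
  have hp : (1 : ℝ) ≤ ℓ j := by exact_mod_cast h.one_le_ell j
  have hp' : (1 : ℝ) ≤ ℓ (j + 1) := by exact_mod_cast h.one_le_ell (j + 1)
  have : 1 / (x j + e j) ≤ (ℓ j : ℝ) / ℓ (j + 1) := by
    rw [div_le_div_iff₀ (by positivity) (by positivity)]
    linarith
  have h₂ : 1 / x j ≤ 1 / (x j + e j) + e j := by
    rw [← sub_le_iff_le_add', div_sub_div _ _ (by positivity) (by positivity),
      div_le_iff₀ (by positivity)]
    have : 1 ≤ x j * (x j + e j) := by nlinarith
    nlinarith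
  linarith

lemma liminf_div (h : HasSlopes P ℓ) (hx2 : ∀ j, 2 ≤ x j) (hx : ∀ j, x j * ℓ j ≤ ℓ (j + 1))
    (he0 : ∀ j, 0 ≤ e j) (he : ∀ j, ℓ (j + 1) ≤ x j * ℓ j + e j * ℓ j)
    (hlim : Tendsto e atTop (nhds 0)) :
    atTop.liminf (fun q => (P q : ℝ) / q) = atTop.liminf (fun j => 1 + 1 / x j) := by
  obtain ⟨hb₁, hb₂⟩ := h.isBoundedUnder_div
  obtain ⟨hv₁, hv₂⟩ := isBoundedUnder_of_mem_Icc (u := fun j => 1 + 1 / x j)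
    (a := 1) (b := 2) (.of_forall fun j => by
      have := one_div_mem_Icc (hx2 j)
      constructor <;> linarith [this.1, this.2])
  refine le_antisymm (liminf_le_liminf_of_approx hv₁ hb₂ fun ε hε N => ?_)
    (liminf_le_liminf_of_approx hb₁ hv₂ fun ε hε N => ?_)
  · filter_upwards [eventually_ge_atTop N] with j hj
    refine ⟨ℓ (j + 1), by have := h.lt_ell (j + 1); omega, ?_⟩
    have hp : (1 : ℝ) ≤ ℓ (j + 1) := by exact_mod_cast h.one_le_ell (j + 1)
    have hxj := hx2 j
    rw [h.apply_ell, Nat.cast_add, add_div, div_self (by positivity)]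
    have : (ℓ j : ℝ) / ℓ (j + 1) ≤ 1 / x j := by
      rw [div_le_div_iff₀ (by positivity) (by positivity)]
      linarith [hx j]
    linarith
  · obtain ⟨M, hM⟩ := eventually_atTop.1 (hlim.eventually_lt_const (half_pos hε))
    filter_upwards [eventually_gt_atTop (ℓ (max N M + 1)),
      tendsto_one_div_atTop_nhds_zero_nat.eventually_lt_const (half_pos hε)] with q hq hqε
    obtain ⟨j, hj, h₁, h₂⟩ := h.exists_between hq
    obtain ⟨i, hi, hle⟩ := h.exists_le_div_of_mem h₁ h₂
    refine ⟨i, by omega, ?_⟩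
    have := h.one_div_le_ratio_add (hx2 i) (he0 i) (he i)
    linarith [hM i (by omega)]

lemma limsup_div (h : HasSlopes P ℓ) (hx2 : ∀ j, 2 ≤ x j) (hx : ∀ j, x j * ℓ j ≤ ℓ (j + 1))
    (he0 : ∀ j, 0 ≤ e j) (he : ∀ j, ℓ (j + 1) ≤ x j * ℓ j + e j * ℓ j)
    (hlim : Tendsto e atTop (nhds 0)) :
    atTop.limsup (fun q => (P q : ℝ) / q) =
      atTop.limsup (fun j => 3 / 2 + 1 / (4 * x j - 2)) := by
  obtain ⟨hb₁, hb₂⟩ := h.isBoundedUnder_div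
  obtain ⟨hv₁, hv₂⟩ := isBoundedUnder_of_mem_Icc
    (u := fun j => 3 / 2 + 1 / (4 * x j - 2)) (a := 1) (b := 3) (.of_forall fun j => by
      have := one_div_sub_mem_Icc (hx2 j)
      constructor <;> linarith [this.1, this.2])
  refine le_antisymm (limsup_le_limsup_of_approx hb₂ hv₁ fun ε hε N => ?_)
    (limsup_le_limsup_of_approx hv₂ hb₁ fun ε hε N => ?_)
  · filter_upwards [eventually_gt_atTop (ℓ (N + 1))] with q hq
    obtain ⟨j, hj, h₁, h₂⟩ := h.exists_between hq
    exact ⟨j, hj, by linarith [h.div_le_of_mem h₁ h₂ (hx2 j) (hx j)]⟩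
  · obtain ⟨M, hM⟩ := eventually_atTop.1
      (tendsto_one_div_atTop_nhds_zero_nat.eventually_lt_const (half_pos hε))
    filter_upwards [eventually_ge_atTop (max N M),
      hlim.eventually_lt_const (half_pos hε)] with j hj hje
    have a₁ := h.two_mul_le j
    have a₂ : 2 * ℓ (j + 1) ≤ ℓ (j + 2) := h.two_mul_le (j + 1)
    have a₃ := h.one_le_ell j
    have a₄ := h.lt_ell (j + 1)
    refine ⟨2 * ℓ (j + 1) - ℓ j, by omega, ?_⟩
    have hP := h.apply_eq_min (j := j) (q := 2 * ℓ (j + 1) - ℓ j) (by omega) (by omega)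
    obtain ⟨q, hq⟩ : ∃ q, q = 2 * ℓ (j + 1) - ℓ j := ⟨_, rfl⟩
    rw [← hq] at hP ⊢
    have hqε := hM q (by omega)
    have hPq : (P q : ℝ) = q + ℓ (j + 1) - 1 := by
      have : P q + 1 = q + ℓ (j + 1) := by omega
      rw [eq_sub_iff_add_eq]
      exact_mod_cast this
    have hqr : (q : ℝ) = 2 * ℓ (j + 1) - ℓ j := by
      rw [eq_sub_iff_add_eq]
      exact_mod_cast show q + ℓ j = 2 * ℓ (j + 1) by omega
    have hp : (1 : ℝ) ≤ ℓ j := by exact_mod_cast a₃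
    have hp' : 2 * (ℓ j : ℝ) ≤ ℓ (j + 1) := by exact_mod_cast a₁
    have hq0 : (0 : ℝ) < q := by linarith
    have key : 1 / 2 + 1 / (4 * x j - 2) ≤ (ℓ (j + 1) : ℝ) / q + e j := by
      have hxj := hx2 j
      have hex := hx j
      have hee := he j
      have hqj : (ℓ j : ℝ) ≤ q * (2 * x j - 1) := by nlinarith
      have heq := mul_le_mul_of_nonneg_left hqj (he0 j)
      rw [show 1 / 2 + 1 / (4 * x j - 2) = x j / (2 * x j - 1) by
          rw [show 4 * x j - 2 = 2 * (2 * x j - 1) by ring]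
          have : 2 * x j - 1 ≠ 0 := by linarith
          field_simp
          ring,
        div_add' _ _ _ hq0.ne', div_le_div_iff₀ (by linarith) hq0]
      rw [hqr] at heq ⊢
      nlinarith
    have : (P q : ℝ) / q = 1 + (ℓ (j + 1) : ℝ) / q - 1 / q := by
      rw [hPq]; field_simp
    linarith

end HasSlopes

/-- Regrouping the indices `j` into the pairs `{2 n - 3, 2 n - 2}`. -/
lemma liminf_pair {L' g : ℕ → ℝ} (hx2 : ∀ j, 2 ≤ x j)
    (hL' : ∀ n, x (2 * n + 1) = L' (n + 1)) (hg : ∀ n, x (2 * n) = g (n + 1)) :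
    atTop.liminf (fun j => 1 / x j) =
      atTop.liminf (fun n => 1 / max (L' (n - 1)) (g n)) := by
  obtain ⟨hv₁, hv₂⟩ := isBoundedUnder_of_mem_Icc
    (.of_forall fun j => one_div_mem_Icc (hx2 j))
  have hL₂ (n : ℕ) : 2 ≤ L' (n + 1) := hL' n ▸ hx2 _
  have hg₂ (n : ℕ) : 2 ≤ g (n + 1) := hg n ▸ hx2 _
  obtain ⟨hw₁, hw₂⟩ := isBoundedUnder_of_mem_Icc
    (u := fun n => 1 / max (L' (n - 1)) (g n)) (a := 0) (b := 1) (by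
      filter_upwards [eventually_ge_atTop 1] with n hn
      obtain ⟨m, rfl⟩ := Nat.exists_eq_add_of_le' hn
      exact one_div_mem_Icc (le_max_of_le_right (hg₂ m)))
  refine le_antisymm (liminf_le_liminf_of_approx hw₁ hv₂ fun ε hε N => ?_)
    (liminf_le_liminf_of_approx hv₁ hw₂ fun ε hε N => ?_)
  · filter_upwards [eventually_ge_atTop (N + 2)] with n hn
    obtain ⟨m, rfl⟩ := Nat.exists_eq_add_of_le' (show 2 ≤ n by omega)
    rcases max_choice (L' (m + 2 - 1)) (g (m + 2)) with h | h <;> rw [h]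
    · exact ⟨2 * m + 1, by omega, by rw [hL' m, show m + 2 - 1 = m + 1 by omega]; linarith⟩
    · exact ⟨2 * (m + 1), by omega, by rw [hg (m + 1)]; linarith⟩
  · filter_upwards [eventually_ge_atTop (2 * N)] with j hj
    refine ⟨(j + 1) / 2 + 1, by omega, le_add_of_le_of_nonneg ?_ hε.le⟩
    have hxj := hx2 j
    refine one_div_le_one_div_of_le (by linarith) ?_
    rcases Nat.even_or_odd' j with ⟨i, rfl | rfl⟩
    · rw [hg, show (2 * i + 1) / 2 + 1 = i + 1 by omega]
      exact le_max_right _ _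
    · rw [hL', show (2 * i + 1 + 1) / 2 + 1 - 1 = i + 1 by omega]
      exact le_max_left _ _

/-- Regrouping the indices `j` into the pairs `{2 n - 3, 2 n - 2}`. -/
lemma limsup_pair {L' g : ℕ → ℝ} (hx2 : ∀ j, 2 ≤ x j)
    (hL' : ∀ n, x (2 * n + 1) = L' (n + 1)) (hg : ∀ n, x (2 * n) = g (n + 1)) :
    atTop.limsup (fun j => 1 / (4 * x j - 2)) =
      atTop.limsup (fun n => 1 / (4 * min (L' (n - 1)) (g n) - 2)) := by
  obtain ⟨hv₁, hv₂⟩ := isBoundedUnder_of_mem_Icc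
    (.of_forall fun j => one_div_sub_mem_Icc (hx2 j))
  have hL₂ (n : ℕ) : 2 ≤ L' (n + 1) := hL' n ▸ hx2 _
  have hg₂ (n : ℕ) : 2 ≤ g (n + 1) := hg n ▸ hx2 _
  have hmin (n : ℕ) : 2 ≤ min (L' (n + 1)) (g (n + 2)) := le_min (hL₂ n) (hg₂ (n + 1))
  obtain ⟨hw₁, hw₂⟩ := isBoundedUnder_of_mem_Icc
    (u := fun n => 1 / (4 * min (L' (n - 1)) (g n) - 2)) (a := 0) (b := 1) (by
      filter_upwards [eventually_ge_atTop 2] with n hn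
      obtain ⟨m, rfl⟩ := Nat.exists_eq_add_of_le' hn
      exact one_div_sub_mem_Icc (hmin m))
  refine le_antisymm (limsup_le_limsup_of_approx hv₂ hw₁ fun ε hε N => ?_)
    (limsup_le_limsup_of_approx hw₂ hv₁ fun ε hε N => ?_)
  · filter_upwards [eventually_ge_atTop (2 * N + 1)] with j hj
    refine ⟨(j + 1) / 2 + 1, by omega, le_add_of_le_of_nonneg ?_ hε.le⟩
    obtain ⟨m, hm⟩ := Nat.exists_eq_add_of_le' (show 2 ≤ (j + 1) / 2 + 1 by omega)
    rw [hm, show m + 2 - 1 = m + 1 by omega]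
    refine one_div_le_one_div_of_le (by linarith [hmin m]) ?_
    suffices min (L' (m + 1)) (g (m + 2)) ≤ x j by linarith
    rcases Nat.even_or_odd' j with ⟨i, rfl | rfl⟩
    · rw [hg, show i + 1 = m + 2 by omega]
      exact min_le_right _ _
    · rw [hL', show i = m by omega]
      exact min_le_left _ _
  · filter_upwards [eventually_ge_atTop (N + 2)] with n hn
    obtain ⟨m, rfl⟩ := Nat.exists_eq_add_of_le' (show 2 ≤ n by omega)
    rcases min_choice (L' (m + 2 - 1)) (g (m + 2)) with h | h <;> rw [h]
    · exact ⟨2 * m + 1, by omega, by rw [hL' m, show m + 2 - 1 = m + 1 by omega]; linarith⟩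
    · exact ⟨2 * (m + 1), by omega, by rw [hg (m + 1)]; linarith⟩

end Asymptotics

/-- The repetition numbers for which `spacedWord` refines `Cseq L γ`. -/
def interleaved (L γ : ℕ → ℕ) (j : ℕ) : ℕ :=
  if j % 2 = 0 then γ (j / 2 + 1) else L (j / 2 + 1) - 1

section Interleaved

variable {L γ : ℕ → ℕ}

lemma interleaved_even (i : ℕ) : interleaved L γ (2 * i) = γ (i + 1) := by
  rw [interleaved, if_pos (by omega), show 2 * i / 2 = i by omega]

lemma interleaved_odd (i : ℕ) : interleaved L γ (2 * i + 1) = L (i + 1) - 1 := by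
  rw [interleaved, if_neg (by omega), show (2 * i + 1) / 2 = i by omega]

lemma spacer_even (i : ℕ) : spacer (2 * i) = [true] := by
  rw [spacer, show (2 * i + 1) % 2 = 1 by omega]
  rfl

lemma spacer_odd (i : ℕ) : spacer (2 * i + 1) = [] := by
  rw [spacer, show (2 * i + 1 + 1) % 2 = 0 by omega]
  rfl

variable (hL : ∀ n, 1 ≤ n → 2 ≤ L n)
include hL

lemma one_le_interleaved (hγ : ∀ n, 1 ≤ n → 2 ≤ γ n) (j : ℕ) : 1 ≤ interleaved L γ j := by
  have h₁ := hL (j / 2 + 1) (by omega)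
  have h₂ := hγ (j / 2 + 1) (by omega)
  unfold interleaved
  split_ifs <;> omega

lemma Cseq_succ_eq (n : ℕ) : Cseq L γ (n + 1) = spacedWord (interleaved L γ) (2 * n) := by
  induction n with
  | zero => rfl
  | succ n ih =>
    rw [Cseq, ih, show 2 * (n + 1) = 2 * n + 1 + 1 by ring, spacedWord, spacer_odd,
      interleaved_odd, List.append_nil]
    have h : spacedWord (interleaved L γ) (2 * n + 1) =
        (List.replicate (γ (n + 1)) (spacedWord (interleaved L γ) (2 * n) ++ [true])).flatten ++
          spacedWord (interleaved L γ) (2 * n) := by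
      rw [spacedWord, spacer_even, interleaved_even]
    rw [← h]
    have := hL (n + 1) (by omega)
    conv_lhs => rw [show L (n + 1) = L (n + 1) - 1 + 1 by omega, flatten_replicate_add,
      flatten_replicate_one]

lemma inLangC_iff (w : List Bool) : InLangC L γ w ↔ InSpacedLang (interleaved L γ) w := by
  constructor
  · rintro ⟨_ | n, h⟩
    · exact ⟨0, h⟩
    · exact ⟨2 * n, Cseq_succ_eq hL n ▸ h⟩
  · rintro ⟨j, h⟩
    exact ⟨j + 1, Cseq_succ_eq hL j ▸ h.trans (spacedWord_suffix (by omega)).isInfix⟩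

lemma complexityC_eq (q : ℕ) :
    complexityC L γ q = (spacedLangOfLength (interleaved L γ) q).ncard := by
  simp only [complexityC, spacedLangOfLength, inLangC_iff hL]

end Interleaved

/-- `p(h_{n+1}) = (1 + 1/L_n) h_{n+1}` for all `n ≥ 1`; moreover if `γ_n / h_n → 0` then
`liminf p(q)/q = 1 + liminf 1/max(L_{n-1}, γ_n + 1)` and
`limsup p(q)/q = 3/2 + limsup 1/(4 min(L_{n-1}, γ_n + 1) - 2)`. -/
theorem stmt17 (L γ : ℕ → ℕ) (hL : ∀ n, 1 ≤ n → 2 ≤ L n) (hγ : ∀ n, 1 ≤ n → 2 ≤ γ n) :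
    (∀ n, 1 ≤ n →
      (complexityC L γ ((Cseq L γ (n + 1)).length) : ℝ) =
        (1 + 1 / (L n : ℝ)) * ((Cseq L γ (n + 1)).length : ℝ)) ∧
    (Tendsto (fun n => (γ n : ℝ) / ((Cseq L γ n).length : ℝ)) atTop (nhds 0) →
      (atTop.liminf (fun q : ℕ => (complexityC L γ q : ℝ) / (q : ℝ)) =
          1 + atTop.liminf (fun n : ℕ => 1 / (max (L (n - 1) : ℝ) ((γ n : ℝ) + 1))) ∧
        atTop.limsup (fun q : ℕ => (complexityC L γ q : ℝ) / (q : ℝ)) =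
          3 / 2 + atTop.limsup
            (fun n : ℕ => 1 / (4 * min (L (n - 1) : ℝ) ((γ n : ℝ) + 1) - 2)))) := by
  have hslopes := hasSlopes_spacedLang (one_le_interleaved hL hγ)
  simp only [← complexityC_eq hL] at hslopes
  refine ⟨fun n hn => ?_, fun hlim => ?_⟩
  · obtain ⟨m, rfl⟩ := Nat.exists_eq_add_of_le' hn
    have h₁ := hslopes.apply_ell (2 * m + 1)
    have h₂ := length_spacedWord_succ (k := interleaved L γ) (2 * m + 1)
    have hL₁ := hL (m + 1) hn
    rw [spacer_odd, List.length_nil, add_zero, interleaved_odd, ← Nat.succ_mul,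
      Nat.succ_eq_add_one, Nat.sub_add_cancel (by omega)] at h₂
    have hL₀ : (L (m + 1) : ℝ) ≠ 0 := by exact_mod_cast (by omega : L (m + 1) ≠ 0)
    rw [Cseq_succ_eq hL, show 2 * (m + 1) = 2 * m + 1 + 1 by ring, h₁, Nat.cast_add, h₂]
    push_cast
    field_simp
  · set k := interleaved L γ
    set x : ℕ → ℝ := fun j => (k j : ℝ) + 1
    set e : ℕ → ℝ := fun j => (k j : ℝ) * (spacer j).length / (spacedWord k j).length with he
    have hx2 (j : ℕ) : 2 ≤ x j := by
      have : (1 : ℝ) ≤ k j := by exact_mod_cast one_le_interleaved hL hγ j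
      simp only [x]
      linarith
    have hlen (j : ℕ) : ((spacedWord k (j + 1)).length : ℝ) =
        x j * (spacedWord k j).length + e j * (spacedWord k j).length := by
      have : ((spacedWord k j).length : ℝ) ≠ 0 := by
        exact_mod_cast Nat.one_le_iff_ne_zero.1 (one_le_length_spacedWord j)
      rw [length_spacedWord_succ, he, div_mul_cancel₀ _ this]
      push_cast
      ring
    have he0 (j : ℕ) : 0 ≤ e j := by positivity
    have hx (j : ℕ) : x j * (spacedWord k j).length ≤ (spacedWord k (j + 1)).length := by
      rw [hlen]
      exact le_add_of_nonneg_right (mul_nonneg (he0 j) (Nat.cast_nonneg _))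
    have helim : Tendsto e atTop (nhds 0) := by
      have hhalf : Tendsto (fun j : ℕ => j / 2 + 1) atTop atTop :=
        tendsto_atTop_atTop.2 fun b => ⟨2 * b, fun j hj => by omega⟩
      refine squeeze_zero he0 (fun j => ?_) (hlim.comp hhalf)
      rcases Nat.even_or_odd' j with ⟨i, rfl | rfl⟩
      · simp [e, k, interleaved_even, spacer_even, Cseq_succ_eq hL]
      · simp only [e, spacer_odd, List.length_nil, Nat.cast_zero, mul_zero, zero_div,
          Function.comp_apply]
        positivity
    have hodd (n : ℕ) : x (2 * n + 1) = L (n + 1) := by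
      have := hL (n + 1) (by omega)
      simp only [x, k, interleaved_odd]
      rw [Nat.cast_sub (by omega)]
      simp
    have heven (n : ℕ) : x (2 * n) = γ (n + 1) + 1 := by
      simp only [x, k, interleaved_even]
    rw [hslopes.liminf_div hx2 hx he0 (fun j => (hlen j).le) helim,
      hslopes.limsup_div hx2 hx he0 (fun j => (hlen j).le) helim,
      ← liminf_pair (L' := fun n => (L n : ℝ)) (g := fun n => (γ n : ℝ) + 1) hx2 hodd heven,
      ← limsup_pair (L' := fun n => (L n : ℝ)) (g := fun n => (γ n : ℝ) + 1) hx2 hodd heven]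
    obtain ⟨hv₁, hv₂⟩ := isBoundedUnder_of_mem_Icc
      (.of_forall fun j => one_div_mem_Icc (hx2 j))
    obtain ⟨hw₁, hw₂⟩ := isBoundedUnder_of_mem_Icc
      (.of_forall fun j => one_div_sub_mem_Icc (hx2 j))
    exact ⟨liminf_const_add _ _ _ hv₁.isCoboundedUnder_ge hv₂,
      limsup_const_add _ _ _ hw₁ hw₂.isCoboundedUnder_le⟩
end

section
/- For every function f : N -> R with f(q) -> infinity, there exist integer sequences gamma_n >= 2 and L_n >= 2 such that the associated subshift satisfies p(q) < (3/2) q + f(q) for all sufficiently large q, and p(h_n) < h_n + f(h_n) for all n >= 2. -/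
open Filter

/-- All words satisfying `p` lie in a finite set of at most `N` words. -/
def CoveredBy (p : List Bool → Prop) (N : ℕ) : Prop :=
  ∃ T : Finset (List Bool), T.card ≤ N ∧ ∀ w, p w → w ∈ T

namespace CoveredBy

theorem mono {p p' : List Bool → Prop} {N : ℕ} (h : CoveredBy p' N) (hp : ∀ w, p w → p' w) :
    CoveredBy p N := by
  obtain ⟨T, hT, hw⟩ := h
  exact ⟨T, hT, fun w h => hw w (hp w h)⟩

theorem or {p p' : List Bool → Prop} {N N' : ℕ} (h : CoveredBy p N) (h' : CoveredBy p' N') :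
    CoveredBy (fun w => p w ∨ p' w) (N + N') := by
  classical
  obtain ⟨T, hT, hw⟩ := h
  obtain ⟨T', hT', hw'⟩ := h'
  refine ⟨T ∪ T', (Finset.card_union_le _ _).trans (by omega), fun w h => ?_⟩
  rw [Finset.mem_union]
  exact h.imp (hw w) (hw' w)

theorem ncard_le {p : List Bool → Prop} {N : ℕ} (h : CoveredBy p N) :
    Set.ncard {w | p w} ≤ N := by
  obtain ⟨T, hT, hw⟩ := h
  have := Set.ncard_le_ncard (s := {w | p w}) (t := (T : Set (List Bool)))
    (fun w h => hw w h) T.finite_toSet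
  rw [Set.ncard_coe_finset] at this
  omega

end CoveredBy

/-- The power `P ^ k` of a word. -/
def wordPow (P : List Bool) (k : ℕ) : List Bool := (List.replicate k P).flatten

theorem wordPow_zero (P : List Bool) : wordPow P 0 = [] := rfl

theorem wordPow_succ (P : List Bool) (k : ℕ) : wordPow P (k + 1) = P ++ wordPow P k := by
  simp [wordPow, List.replicate_succ]

theorem wordPow_add (P : List Bool) (j k : ℕ) :
    wordPow P (j + k) = wordPow P j ++ wordPow P k := by
  rw [wordPow, ← List.replicate_append_replicate, List.flatten_append, wordPow, wordPow]

theorem wordPow_succ' (P : List Bool) (k : ℕ) : wordPow P (k + 1) = wordPow P k ++ P := by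
  simp [wordPow, List.replicate_succ']

theorem length_wordPow (P : List Bool) (k : ℕ) : (wordPow P k).length = k * P.length := by
  simp [wordPow]

/-- `w` is a factor of some power of `P`. -/
def InPow (P w : List Bool) : Prop := ∃ k, w <:+: wordPow P k

theorem InPow.of_infix {P v w : List Bool} (h : InPow P v) (hw : w <:+: v) : InPow P w := by
  obtain ⟨k, hk⟩ := h
  exact ⟨k, hw.trans hk⟩

theorem getElem?_wordPow (P : List Bool) (k i : ℕ) (hi : i < k * P.length) :
    (wordPow P k)[i]? = P[i % P.length]? := by
  induction k generalizing i with
  | zero => simp at hi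
  | succ k ih =>
    rw [wordPow_succ]
    rcases lt_or_ge i P.length with h | h
    · rw [List.getElem?_append_left h, Nat.mod_eq_of_lt h]
    · rw [List.getElem?_append_right h, ih _ (by rw [add_mul] at hi; omega),
        ← Nat.mod_eq_sub_mod h]

theorem coveredBy_inPow (P : List Bool) (q : ℕ) (hP : 0 < P.length) :
    CoveredBy (fun w => w.length = q ∧ InPow P w) P.length := by
  classical
  refine ⟨(Finset.range P.length).image fun i =>
    (List.range q).map fun k => (P[(i + k) % P.length]?).getD false,
    Finset.card_image_le.trans (by simp), ?_⟩
  rintro w ⟨hq, k, a, b, hw⟩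
  refine Finset.mem_image.2 ⟨a.length % P.length, Finset.mem_range.2 (Nat.mod_lt _ hP), ?_⟩
  have hlen : a.length + q + b.length = k * P.length := by
    rw [← length_wordPow, ← hw]; simp [hq]; omega
  apply List.ext_getElem
  · simp [hq]
  intro i h1 h2
  have h3 := getElem?_wordPow P k (a.length + i) (by omega)
  rw [← hw, List.append_assoc, List.getElem?_append_right (by omega),
    List.getElem?_append_left (by omega)] at h3
  simp [← h3, h2]

/-- The word `w` reads across the centre `c` of `A ++ c ++ B`. -/
def Straddles (A c B w : List Bool) : Prop :=
  ∃ a b, a <:+ A ∧ b <+: B ∧ w = a ++ c ++ b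

theorem infix_append_cases {A B w : List Bool} (h : w <:+: A ++ B) :
    w <:+: A ∨ w <:+: B ∨ Straddles A [] B w := by
  obtain ⟨s, t, h⟩ := h
  rw [List.append_assoc] at h
  rcases List.append_eq_append_iff.1 h with ⟨d, rfl, h'⟩ | ⟨c, rfl, rfl⟩
  · rcases List.append_eq_append_iff.1 h' with ⟨c, rfl, -⟩ | ⟨b, rfl, rfl⟩
    · exact Or.inl ⟨s, c, by simp⟩
    · exact Or.inr (Or.inr ⟨d, b, ⟨s, rfl⟩, ⟨t, rfl⟩, by simp⟩)
  · exact Or.inr (Or.inl ⟨c, t, by simp⟩)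

theorem infix_append_singleton_cases {A B w : List Bool} {x : Bool}
    (h : w <:+: A ++ [x] ++ B) :
    w <:+: A ∨ w <:+: B ∨ Straddles A [x] B w := by
  rw [List.append_assoc] at h
  rcases infix_append_cases h with h | h | ⟨a, b, ha, hb, rfl⟩
  · exact Or.inl h
  · rcases List.infix_cons_iff.1 h with h | h
    · rcases List.prefix_cons_iff.1 h with rfl | ⟨b, rfl, hb⟩
      · exact Or.inl List.nil_infix
      · exact Or.inr (Or.inr ⟨[], b, List.nil_suffix, hb, rfl⟩)
    · exact Or.inr (Or.inl h)
  · rw [List.singleton_append] at hb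
    rcases List.prefix_cons_iff.1 hb with rfl | ⟨b, rfl, hb'⟩
    · exact Or.inl (by simpa using ha.isInfix)
    · exact Or.inr (Or.inr ⟨a, b, ha, hb', by simp⟩)

theorem coveredBy_straddles_of_mem (A c B : List Bool) (q : ℕ) (J : Finset ℕ) :
    CoveredBy (fun w => w.length = q ∧
      ∃ a b, a <:+ A ∧ b <+: B ∧ w = a ++ c ++ b ∧ a.length ∈ J) J.card := by
  classical
  refine ⟨J.image fun j => A.drop (A.length - j) ++ c ++ B.take (q - c.length - j),
    Finset.card_image_le, ?_⟩
  rintro w ⟨hq, a, b, ha, hb, rfl, hJ⟩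
  refine Finset.mem_image.2 ⟨_, hJ, ?_⟩
  have hb' : q - c.length - a.length = b.length := by
    simp only [List.length_append] at hq; omega
  rw [hb', ← List.prefix_iff_eq_take.1 hb, ← List.suffix_iff_eq_drop.1 ha]

theorem coveredBy_straddles (A c B : List Bool) (q : ℕ) :
    CoveredBy (fun w => w.length = q ∧ Straddles A c B w) (q + 1) := by
  have := coveredBy_straddles_of_mem A c B q (Finset.range (q + 1))
  rw [Finset.card_range] at this
  refine this.mono ?_
  rintro w ⟨hq, a, b, ha, hb, rfl⟩
  refine ⟨hq, a, b, ha, hb, rfl, Finset.mem_range.2 ?_⟩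
  simp only [List.length_append] at hq; omega

/-- Straddling words either stay inside the inner blocks `X`, `Y`, or are among
`2 * (q - ℓ)` words, where `ℓ` is the common length of the inner blocks. -/
theorem coveredBy_straddles_of_blocks {A c B X Y : List Bool} {q ℓ N : ℕ} (hX : X <:+ A)
    (hY : Y <+: B) (hXl : X.length = ℓ) (hYl : Y.length = ℓ)
    (hN : CoveredBy (fun w => w.length = q ∧ w <:+: X ++ c ++ Y) N) :
    CoveredBy (fun w => w.length = q ∧ Straddles A c B w) (N + 2 * (q - ℓ)) := by
  have hc : (Finset.Ioc ℓ q ∪ Finset.range (q - ℓ)).card ≤ 2 * (q - ℓ) :=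
    (Finset.card_union_le _ _).trans (by simp; omega)
  obtain ⟨T, hT, hw⟩ :=
    hN.or (coveredBy_straddles_of_mem A c B q (Finset.Ioc ℓ q ∪ Finset.range (q - ℓ)))
  refine ⟨T, by omega, ?_⟩
  rintro w ⟨hq, a, b, ha, hb, rfl⟩
  apply hw
  by_cases h : a.length ≤ ℓ ∧ b.length ≤ ℓ
  · obtain ⟨s, rfl⟩ := List.suffix_of_suffix_length_le ha hX (by omega)
    obtain ⟨t, rfl⟩ := List.prefix_of_prefix_length_le hb hY (by omega)
    exact Or.inl ⟨hq, s, t, by simp⟩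
  · refine Or.inr ⟨hq, a, b, ha, hb, rfl, ?_⟩
    simp only [List.length_append] at hq
    simp only [Finset.mem_union, Finset.mem_Ioc, Finset.mem_range]
    omega

/-- Concatenations of copies of `X` separated by spacers taken from `S`. -/
inductive BlockChain (X : List Bool) (S : Set (List Bool)) : List Bool → Prop
  | base : BlockChain X S X
  | cons {s v : List Bool} : s ∈ S → BlockChain X S v → BlockChain X S (X ++ s ++ v)

namespace BlockChain

variable {X Y Z s u v w : List Bool} {S : Set (List Bool)}

theorem append (hs : s ∈ S) (hu : BlockChain X S u) (hv : BlockChain X S v) :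
    BlockChain X S (u ++ s ++ v) := by
  induction hu with
  | base => exact cons hs hv
  | cons ht _ ih => simpa using cons ht ih

theorem trans (hZ : BlockChain Y S Z) (hY : BlockChain X S Y) : BlockChain X S Z := by
  induction hZ with
  | base => exact hY
  | cons ht _ ih => exact append ht hY ih

theorem startsWith_block (hv : BlockChain X S v) : X <+: v := by
  cases hv with
  | base => exact List.prefix_rfl
  | cons => exact ⟨_, (List.append_assoc _ _ _).symm⟩

theorem wordPow_succ (hS : [] ∈ S) (k : ℕ) : BlockChain X S (wordPow X (k + 1)) := by
  induction k with
  | zero => simpa [wordPow] using base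
  | succ k ih => rw [_root_.wordPow_succ]; simpa using cons hS ih

theorem wordPow_append (hs : s ∈ S) (k : ℕ) : BlockChain X S (wordPow (X ++ s) k ++ X) := by
  induction k with
  | zero => simpa [wordPow] using base
  | succ k ih => rw [_root_.wordPow_succ]; simpa using cons hs ih

/-- A factor of a chain that is at most one letter longer than the block meets at most
two blocks. -/
theorem infix_pair (hv : BlockChain X S v) (hw : w <:+: v) (hl : w.length ≤ X.length + 1) :
    w <:+: X ∨ ∃ s ∈ S, w <:+: X ++ s ++ X := by
  induction hv with
  | base => exact Or.inl hw
  | @cons s v hs hv ih =>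
    rcases infix_append_cases hw with h | h | ⟨a, b, ⟨a', ha⟩, hb, rfl⟩
    · exact Or.inr ⟨s, hs, h.trans (List.prefix_append _ _).isInfix⟩
    · exact ih h
    · simp only [List.append_nil, List.length_append] at hl
      rcases Nat.lt_or_ge X.length b.length with h | h
      · obtain rfl : a = [] := List.eq_nil_of_length_eq_zero (by omega)
        exact ih (by simpa using hb.isInfix)
      · obtain ⟨t, ht⟩ := List.prefix_of_prefix_length_le hb hv.startsWith_block h
        refine Or.inr ⟨s, hs, a', t, ?_⟩
        conv_rhs => rw [← ha, ← ht]
        simp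

end BlockChain

/-- The spacers occurring between consecutive blocks. -/
def spacers : Set (List Bool) := {[], [true]}

section TwoLevel

variable (B : List Bool) (g l : ℕ)

/-- The period `(B 1)^g B` of the next block. -/
def periodWord : List Bool := wordPow (B ++ [true]) g ++ B

theorem length_periodWord : (periodWord B g).length = g * (B.length + 1) + B.length := by
  simp [periodWord, length_wordPow]

theorem inPow_periodWord : InPow (B ++ [true]) (periodWord B g) :=
  ⟨g + 1, [], [true], by simp [periodWord, wordPow_succ']⟩

theorem inPow_periodWord_pair :
    InPow (B ++ [true]) (periodWord B g ++ [true] ++ periodWord B g) :=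
  ⟨g + 1 + (g + 1), [], [true], by simp [periodWord, wordPow_add, wordPow_succ']⟩

theorem prefix_periodWord (hg : g ≠ 0) : B <+: periodWord B g := by
  obtain ⟨k, rfl⟩ := Nat.exists_eq_succ_of_ne_zero hg
  exact ⟨[true] ++ wordPow (B ++ [true]) k ++ B, by simp [periodWord, wordPow_succ]⟩

theorem suffix_periodWord : B <:+ periodWord B g := ⟨_, rfl⟩

theorem blockChain_wordPow_periodWord (hl : l ≠ 0) :
    BlockChain B spacers (wordPow (periodWord B g) l) := by
  obtain ⟨k, rfl⟩ := Nat.exists_eq_succ_of_ne_zero hl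
  exact (BlockChain.wordPow_succ (by simp [spacers]) k).trans
    (BlockChain.wordPow_append (by simp [spacers]) g)

theorem prefix_wordPow (P : List Bool) (hl : l ≠ 0) : P <+: wordPow P l := by
  obtain ⟨k, rfl⟩ := Nat.exists_eq_succ_of_ne_zero hl
  exact ⟨_, (wordPow_succ P k).symm⟩

theorem suffix_wordPow (P : List Bool) (hl : l ≠ 0) : P <:+ wordPow P l := by
  obtain ⟨k, rfl⟩ := Nat.exists_eq_succ_of_ne_zero hl
  exact ⟨wordPow P k, (wordPow_succ' P k).symm⟩

/-- A short factor of a concatenation of blocks `P^l` is a factor of a power of `P`, or reads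
across a spacer. -/
theorem inPow_or_straddles {P v w : List Bool} {l : ℕ}
    (hv : BlockChain (wordPow P l) spacers v) (hw : w <:+: v)
    (hlen : w.length ≤ (wordPow P l).length + 1) :
    InPow P w ∨ Straddles (wordPow P l) [true] (wordPow P l) w := by
  rcases hv.infix_pair hw hlen with h | ⟨s, rfl | rfl, h⟩
  · exact Or.inl ⟨l, h⟩
  · exact Or.inl ⟨l + l, by simpa [wordPow_add] using h⟩
  · rcases infix_append_singleton_cases h with h | h | h
    · exact Or.inl ⟨l, h⟩
    · exact Or.inl ⟨l, h⟩
    · exact Or.inr h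

theorem inPow_pair {P w : List Bool} (h : InPow P w) (hlen : w.length ≤ P.length) :
    w <:+: P ∨ Straddles P [] P w := by
  obtain ⟨k, hk⟩ := h
  have hk' : w <:+: wordPow P (k + 1) :=
    hk.trans (by rw [wordPow_succ]; exact (List.suffix_append _ _).isInfix)
  rcases (BlockChain.wordPow_succ (S := {[]}) rfl k).infix_pair hk' (by omega) with
    h | ⟨s, rfl, h⟩
  · exact Or.inl h
  · rw [List.append_nil] at h
    have := infix_append_cases h
    tauto

end TwoLevel

section Language

variable {L γ : ℕ → ℕ}

theorem Cseq_succ_succ (L γ : ℕ → ℕ) (n : ℕ) :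
    Cseq L γ (n + 2) = wordPow (periodWord (Cseq L γ (n + 1)) (γ (n + 1))) (L (n + 1)) := rfl

theorem blockChain_Cseq (hL : ∀ n, 1 ≤ n → 2 ≤ L n) (n j : ℕ) :
    BlockChain (Cseq L γ (n + 1)) spacers (Cseq L γ (n + 1 + j)) := by
  induction j with
  | zero => exact BlockChain.base
  | succ j ih =>
    refine BlockChain.trans ?_ ih
    rw [show n + 1 + (j + 1) = n + j + 2 by omega, Cseq_succ_succ,
      show n + 1 + j = n + j + 1 by omega]
    exact blockChain_wordPow_periodWord _ _ _ (by have := hL (n + j + 1) (by omega); omega)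

theorem exists_blockChain (hL : ∀ n, 1 ≤ n → 2 ≤ L n) (n : ℕ) {w : List Bool}
    (hw : InLangC L γ w) : ∃ v, BlockChain (Cseq L γ (n + 1)) spacers v ∧ w <:+: v := by
  obtain ⟨m, hm⟩ := hw
  rcases le_total (n + 1) m with h | h
  · obtain ⟨j, rfl⟩ := Nat.exists_eq_add_of_le h
    exact ⟨_, blockChain_Cseq hL n j, hm⟩
  · refine ⟨_, BlockChain.base, hm.trans ?_⟩
    cases m with
    | zero =>
      have := (blockChain_Cseq (γ := γ) hL 0 n).startsWith_block.isInfix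
      rwa [show 0 + 1 + n = n + 1 by omega] at this
    | succ m =>
      obtain ⟨j, hj⟩ := Nat.exists_eq_add_of_le h
      rw [hj]
      exact (blockChain_Cseq hL m j).startsWith_block.isInfix

variable {n q : ℕ} {B P : List Bool}

theorem inLangC_cases (hL : ∀ n, 1 ≤ n → 2 ≤ L n)
    (hP : P = periodWord (Cseq L γ (n + 1)) (γ (n + 1)))
    (hq : q ≤ (Cseq L γ (n + 2)).length) {w : List Bool} (hw : w.length = q ∧ InLangC L γ w) :
    InPow P w ∨ Straddles (wordPow P (L (n + 1))) [true] (wordPow P (L (n + 1))) w := by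
  obtain ⟨v, hv, hwv⟩ := exists_blockChain hL (n + 1) hw.2
  rw [Cseq_succ_succ, ← hP] at hv hq
  exact inPow_or_straddles hv hwv (by omega)

theorem complexityC_le_add_period (hL : ∀ n, 1 ≤ n → 2 ≤ L n)
    (hP : P = periodWord (Cseq L γ (n + 1)) (γ (n + 1))) (hP0 : 0 < P.length)
    (hq : q ≤ (Cseq L γ (n + 2)).length) :
    complexityC L γ q ≤ P.length + (q + 1) := by
  refine (((coveredBy_inPow P q hP0).or (coveredBy_straddles (wordPow P (L (n + 1))) [true]
    (wordPow P (L (n + 1))) q)).mono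
    fun w hw => ?_).ncard_le
  exact (inLangC_cases hL hP hq hw).imp (fun h => ⟨hw.1, h⟩) (fun h => ⟨hw.1, h⟩)

theorem coveredBy_straddles_one (hL : ∀ n, 1 ≤ n → 2 ≤ L n)
    (hP : P = periodWord B (γ (n + 1))) :
    CoveredBy (fun w => w.length = q ∧
      Straddles (wordPow P (L (n + 1))) [true] (wordPow P (L (n + 1))) w)
      (B.length + 1 + 2 * (q - P.length)) := by
  have hl : L (n + 1) ≠ 0 := by have := hL (n + 1) (by omega); omega
  refine coveredBy_straddles_of_blocks (suffix_wordPow _ P hl) (prefix_wordPow _ P hl) rfl rfl ?_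
  have := coveredBy_inPow (B ++ [true]) q (by simp)
  rw [List.length_append, List.length_singleton] at this
  refine this.mono fun w hw => ⟨hw.1, InPow.of_infix ?_ hw.2⟩
  rw [hP]
  exact inPow_periodWord_pair _ _

theorem complexityC_le_of_period_le (hL : ∀ n, 1 ≤ n → 2 ≤ L n) (hB : B = Cseq L γ (n + 1))
    (hP : P = periodWord B (γ (n + 1))) (hP0 : 0 < P.length)
    (hq : q ≤ (Cseq L γ (n + 2)).length) :
    complexityC L γ q ≤ P.length + (B.length + 1 + 2 * (q - P.length)) := by
  refine (((coveredBy_inPow P q hP0).or (coveredBy_straddles_one hL hP)).mono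
    fun w hw => ?_).ncard_le
  exact (inLangC_cases hL (hB ▸ hP) hq hw).imp (fun h => ⟨hw.1, h⟩) (fun h => ⟨hw.1, h⟩)

/-- Up to the length of the period, the words of the language are factors of `(B 1)^∞` or
read across the junction of `P P`. -/
theorem complexityC_le_of_le_period {N : ℕ} (hL : ∀ n, 1 ≤ n → 2 ≤ L n)
    (hB : B = Cseq L γ (n + 1)) (hP : P = periodWord B (γ (n + 1)))
    (hq : q ≤ (Cseq L γ (n + 2)).length) (hqP : q ≤ P.length)
    (hN : CoveredBy (fun w => w.length = q ∧ Straddles P [] P w) N) :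
    complexityC L γ q ≤ B.length + 1 + N := by
  have hU := coveredBy_inPow (B ++ [true]) q (by simp)
  rw [List.length_append, List.length_singleton] at hU
  refine ((hU.or hN).mono fun w hw => ?_).ncard_le
  rcases inLangC_cases hL (hB ▸ hP) hq hw with h | ⟨a, b, ha, hb, hab⟩
  · rcases inPow_pair h (by omega) with h | h
    · exact Or.inl ⟨hw.1, InPow.of_infix (hP ▸ inPow_periodWord _ _) h⟩
    · exact Or.inr ⟨hw.1, h⟩
  · left
    refine ⟨hw.1, InPow.of_infix (inPow_periodWord_pair B (γ (n + 1))) ?_⟩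
    have hl : L (n + 1) ≠ 0 := by have := hL (n + 1) (by omega); omega
    have hlen := hw.1
    rw [hab] at hlen
    simp only [List.length_append, List.length_singleton] at hlen
    obtain ⟨s, hs⟩ := List.suffix_of_suffix_length_le ha (suffix_wordPow _ P hl) (by omega)
    obtain ⟨t, ht⟩ := List.prefix_of_prefix_length_le hb (prefix_wordPow _ P hl) (by omega)
    refine ⟨s, t, ?_⟩
    rw [← hP, hab]
    nth_rw 1 [← hs]
    rw [← ht]
    simp

theorem coveredBy_straddles_nil {B' P' : List Bool} {l : ℕ} (hP' : 0 < P'.length)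
    (hB : B = wordPow P' l) (g : ℕ) (hg : g ≠ 0) (q : ℕ) (hB' : B' = periodWord B g) :
    CoveredBy (fun w => w.length = q ∧ Straddles B' [] B' w)
      (P'.length + 2 * (q - B.length)) := by
  subst hB'
  refine coveredBy_straddles_of_blocks (suffix_periodWord B g) (prefix_periodWord B g hg)
    rfl rfl ?_
  refine (coveredBy_inPow P' q hP').mono fun w hw => ⟨hw.1, l + l, ?_⟩
  simpa [wordPow_add, hB] using hw.2

end Language

/-- Block lengths when `γ n` and `L n` are chosen by the rule `N` from the preceding
lengths. -/
def blockLength (N : ℕ → ℕ) : ℕ → ℕ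
  | 0 => 1
  | 1 => 1
  | n + 2 =>
      N (N (blockLength N (n + 1)) * (blockLength N (n + 1) + 1) + blockLength N (n + 1)) *
        (N (blockLength N (n + 1)) * (blockLength N (n + 1) + 1) + blockLength N (n + 1))

theorem length_Cseq (N : ℕ → ℕ) (n : ℕ) :
    (Cseq (fun n => N (N (blockLength N n) * (blockLength N n + 1) + blockLength N n))
      (fun n => N (blockLength N n)) n).length = blockLength N n := by
  induction n using blockLength.induct with
  | case1 => rfl
  | case2 => rfl
  | case3 n ih =>
    rw [Cseq_succ_succ, length_wordPow, length_periodWord, ih, blockLength]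

theorem le_blockLength {N : ℕ → ℕ} (hN : ∀ M, 2 ≤ N M) (n : ℕ) :
    n ≤ blockLength N n := by
  induction n using blockLength.induct with
  | case1 => simp
  | case2 => simp [blockLength]
  | case3 n ih =>
    rw [blockLength]
    nlinarith [hN (N (blockLength N (n + 1)) * (blockLength N (n + 1) + 1)
      + blockLength N (n + 1)), Nat.zero_le (N (blockLength N (n + 1)) *
      (blockLength N (n + 1) + 1))]

/-- For every `f : ℕ → ℝ` with `f(q) → ∞`, there are integer sequences `γ_n ≥ 2` and
`L_n ≥ 2` such that the associated subshift satisfies `p(q) < (3/2) q + f(q)` for all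
sufficiently large `q`, and `p(h_n) < h_n + f(h_n)` for all `n ≥ 2`. -/
theorem stmt19 (f : ℕ → ℝ) (hf : Tendsto f atTop atTop) :
    ∃ (γ L : ℕ → ℕ), (∀ n, 1 ≤ n → 2 ≤ γ n) ∧ (∀ n, 1 ≤ n → 2 ≤ L n) ∧
      (∃ Q : ℕ, ∀ q, Q ≤ q →
        (complexityC L γ q : ℝ) < (3 / 2 : ℝ) * (q : ℝ) + f q) ∧
      ∀ n, 2 ≤ n →
        (complexityC L γ ((Cseq L γ n).length) : ℝ) <
          ((Cseq L γ n).length : ℝ) + f ((Cseq L γ n).length) := by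
  have hex : ∀ M : ℕ, ∃ N, 2 ≤ N ∧ ∀ q, N ≤ q → (M : ℝ) + 4 < f q := by
    intro M
    obtain ⟨N, hN⟩ := eventually_atTop.1 (hf.eventually_gt_atTop ((M : ℝ) + 4))
    exact ⟨max N 2, le_max_right _ _, fun q hq => hN q ((le_max_left _ _).trans hq)⟩
  choose N hN2 hNf using hex
  set γ : ℕ → ℕ := fun n => N (blockLength N n) with hγ
  set L : ℕ → ℕ := fun n => N (N (blockLength N n) * (blockLength N n + 1) + blockLength N n)
  have hlen : ∀ n, (Cseq L γ n).length = blockLength N n := length_Cseq N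
  have hL : ∀ n, 1 ≤ n → 2 ≤ L n := fun n _ => hN2 _
  have hPl : ∀ n, (periodWord (Cseq L γ n) (γ n)).length =
      N (blockLength N n) * (blockLength N n + 1) + blockLength N n := by
    intro n
    rw [length_periodWord, hlen]
  have hlt : ∀ n, blockLength N n < (periodWord (Cseq L γ n) (γ n)).length := by
    intro n
    rw [hPl]
    have := Nat.mul_pos (show 0 < N (blockLength N n) by have := hN2 (blockLength N n); omega)
      (Nat.succ_pos (blockLength N n))
    simp only [Nat.succ_eq_add_one] at this
    omega
  have hfγ : ∀ n q, (periodWord (Cseq L γ n) (γ n)).length ≤ q →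
      (blockLength N n : ℝ) + 4 < f q := by
    intro n q hq
    refine hNf _ _ (le_trans ?_ hq)
    rw [hPl]
    nlinarith
  have hfL : ∀ n q, blockLength N (n + 2) ≤ q →
      ((periodWord (Cseq L γ (n + 1)) (γ (n + 1))).length : ℝ) + 4 < f q := by
    intro n q hq
    refine hNf _ _ (le_trans ?_ hq)
    have h0 := hlt (n + 1)
    rw [blockLength, ← hPl]
    exact Nat.le_mul_of_pos_right _ (by omega)
  refine ⟨γ, L, fun n _ => hN2 _, hL, ⟨blockLength N 2 + 1, fun q hq => ?_⟩, fun n hn => ?_⟩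
  · obtain ⟨n, hn1, hn2⟩ : ∃ n, blockLength N (n + 2) < q ∧ q ≤ blockLength N (n + 3) := by
      have hex : ∃ m, q ≤ blockLength N m := ⟨q, le_blockLength hN2 q⟩
      have hm := Nat.find_spec hex
      have hmin : ∀ m, m < Nat.find hex → ¬ q ≤ blockLength N m := fun m => Nat.find_min hex
      generalize Nat.find hex = m at hm hmin
      match m, hm, hmin with
      | 0, hm, _ => have := le_blockLength hN2 2; simp [blockLength] at hm; omega
      | 1, hm, _ => have := le_blockLength hN2 2; simp [blockLength] at hm; omega
      | 2, hm, _ => omega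
      | m + 3, hm, hmin => exact ⟨m, not_le.1 (hmin (m + 2) (by omega)), hm⟩
    have hq3 : q ≤ (Cseq L γ (n + 3)).length := by rwa [hlen]
    have hP' := hlt (n + 1)
    have hP := hlt (n + 2)
    have hfq := hfL n q hn1.le
    have hfq' := hfγ (n + 2) q
    have hBl := hlen (n + 2)
    generalize hP'e : periodWord (Cseq L γ (n + 1)) (γ (n + 1)) = P' at *
    generalize hPe : periodWord (Cseq L γ (n + 2)) (γ (n + 2)) = P at *
    have hfpos : (4 : ℝ) < f q := lt_of_le_of_lt (by simp) hfq
    have hBP : Cseq L γ (n + 2) = wordPow P' (L (n + 1)) := by rw [Cseq_succ_succ, hP'e]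
    rcases le_total q P.length with hqP | hqP
    · rcases le_total q (2 * blockLength N (n + 2)) with h2 | h2
      · have := complexityC_le_of_le_period (n := n + 1) hL rfl hPe.symm hq3 hqP
          (coveredBy_straddles_nil (by omega) hBP _
            (by have := hN2 (blockLength N (n + 2)); simp only [hγ]; omega) q hPe.symm)
        rw [hBl] at this
        have h3 : 2 * complexityC L γ q ≤ 3 * q + 2 * P'.length + 2 := by omega
        have h4 : 2 * (complexityC L γ q : ℝ) ≤ 3 * q + 2 * P'.length + 2 := by exact_mod_cast h3
        linarith
      · have := complexityC_le_of_le_period (n := n + 1) hL rfl hPe.symm hq3 hqP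
          (coveredBy_straddles _ _ _ q)
        rw [hBl] at this
        have h3 : 2 * complexityC L γ q ≤ 3 * q + 4 := by omega
        have h4 : 2 * (complexityC L γ q : ℝ) ≤ 3 * q + 4 := by exact_mod_cast h3
        linarith
    · have hfq'' := hfq' hqP
      rcases le_total q (2 * P.length) with h2 | h2
      · have := complexityC_le_of_period_le (n := n + 1) hL rfl hPe.symm (by omega) hq3
        rw [hBl] at this
        have h3 : 2 * complexityC L γ q ≤ 3 * q + 2 * blockLength N (n + 2) + 2 := by omega
        have h4 : 2 * (complexityC L γ q : ℝ) ≤ 3 * q + 2 * blockLength N (n + 2) + 2 := by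
          exact_mod_cast h3
        linarith
      · have := complexityC_le_add_period (n := n + 1) hL hPe.symm (by omega) hq3
        have h3 : 2 * complexityC L γ q ≤ 3 * q + 2 := by omega
        have h4 : 2 * (complexityC L γ q : ℝ) ≤ 3 * q + 2 := by exact_mod_cast h3
        linarith
  · obtain ⟨n, rfl⟩ := Nat.exists_eq_add_of_le' hn
    have h1 := complexityC_le_add_period (γ := γ) (n := n) hL rfl
      (by have := hlt (n + 1); omega) le_rfl
    have h2 := hfL n _ (hlen (n + 2)).ge
    have h3 : (complexityC L γ (Cseq L γ (n + 2)).length : ℝ) ≤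
      (periodWord (Cseq L γ (n + 1)) (γ (n + 1))).length + ((Cseq L γ (n + 2)).length + 1) := by
      exact_mod_cast h1
    linarith
end
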